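/- Let p > 2, μ₁ > 0, μ₂ > 0, β > 0, and c₁, c₂ > 0. Then there exists M > 0 such that I(u,v) ≥ −M for every pair (u,v) admissible for (c₁,c₂) that additionally satisfies ∫_{ℝ²}(|∇u|² + |∇v|²) dx < ((p−1)/(p−2)) · (c₁+c₂)²/4. -/

import Mathlib

open MeasureTheory

noncomputable section

abbrev Plane := EuclideanSpace ℝ (Fin 2)

/-- A pair `(u,v)` is admissible for masses `(c₁,c₂)`: `C¹`, in `L² ∩ L^{2p}` with the
prescribed `L²` masses, finite Dirichlet energy, finite `log(1+|x|)`-weighted `L²` norm,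
and integrable logarithmic interaction kernel.  (In Lean, `Real.log 0 = 0`, so the
integrand `log ‖x−y‖ ⋯` is interpreted as `0` on the diagonal.) -/
def Admissible (p c₁ c₂ : ℝ) (u v : Plane → ℝ) : Prop :=
  ContDiff ℝ 1 u ∧ ContDiff ℝ 1 v ∧
  Integrable (fun x => (u x) ^ 2) ∧ Integrable (fun x => (v x) ^ 2) ∧
  Integrable (fun x => |u x| ^ (2 * p)) ∧ Integrable (fun x => |v x| ^ (2 * p)) ∧
  (∫ x, (u x) ^ 2) = c₁ ∧ (∫ x, (v x) ^ 2) = c₂ ∧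
  Integrable (fun x => ‖gradient u x‖ ^ 2 + ‖gradient v x‖ ^ 2) ∧
  Integrable (fun x => Real.log (1 + ‖x‖) * ((u x) ^ 2 + (v x) ^ 2)) ∧
  Integrable (fun z : Plane × Plane =>
    Real.log ‖z.1 - z.2‖ * ((u z.1) ^ 2 + (v z.1) ^ 2) * ((u z.2) ^ 2 + (v z.2) ^ 2))

/-- The energy functional `I(u,v)`. -/
def energy (p μ₁ μ₂ β : ℝ) (u v : Plane → ℝ) : ℝ :=
  (1 / 2) * (∫ x, ‖gradient u x‖ ^ 2 + ‖gradient v x‖ ^ 2) +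
  (1 / 4) * (∫ z : Plane × Plane,
    Real.log ‖z.1 - z.2‖ * ((u z.1) ^ 2 + (v z.1) ^ 2) * ((u z.2) ^ 2 + (v z.2) ^ 2)) -
  (1 / (2 * p)) * (μ₁ * (∫ x, |u x| ^ (2 * p)) + μ₂ * (∫ x, |v x| ^ (2 * p)) +
    2 * β * (∫ x, |u x * v x| ^ p))

open Filter Topology in
/-- The Gagliardo–Nirenberg–Sobolev inequality for `W^{1,1}` functions on the plane of class `C¹`,
without any assumption on the support. -/
lemma lintegral_sq_le_sq_lintegral_fderiv {f : Plane → ℝ} (hf : ContDiff ℝ 1 f)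
    (hfi : Integrable f) :
    ∫⁻ x, ‖f x‖ₑ ^ (2 : ℝ) ≤
      lintegralPowLePowLIntegralFDerivConst (volume : Measure Plane) 2 *
        (∫⁻ x, ‖fderiv ℝ f x‖ₑ) ^ (2 : ℝ) := by
  set C := lintegralPowLePowLIntegralFDerivConst (volume : Measure Plane) 2
  let φ : ContDiffBump (0 : Plane) := ⟨1, 2, one_pos, one_lt_two⟩
  have hφ : ContDiff ℝ 1 (φ : Plane → ℝ) := φ.contDiff
  obtain ⟨K, hK⟩ := (φ.hasCompactSupport.fderiv (𝕜 := ℝ)).exists_bound_of_continuous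
    (hφ.continuous_fderiv one_ne_zero)
  let a : ℕ → ℝ := fun n => ((n : ℝ) + 1)⁻¹
  have ha_pos (n : ℕ) : 0 < a n := by positivity
  have ha : Tendsto a atTop (𝓝 0) := by
    simpa [a, one_div] using tendsto_one_div_add_atTop_nhds_zero_nat (𝕜 := ℝ)
  let g : ℕ → Plane → ℝ := fun n x => φ (a n • x) * f x
  have hχ (n : ℕ) : ContDiff ℝ 1 (fun x : Plane => φ (a n • x)) :=
    hφ.comp (contDiff_const_smul (a n))
  have hg (n : ℕ) : ContDiff ℝ 1 (g n) := (hχ n).mul hf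
  have hg_supp (n : ℕ) : HasCompactSupport (g n) :=
    (φ.hasCompactSupport.comp_smul (ha_pos n).ne').mul_right
  have hg_fderiv (n : ℕ) (x : Plane) :
      ‖fderiv ℝ (g n) x‖ₑ ≤ ‖fderiv ℝ f x‖ₑ + ENNReal.ofReal (a n * K) * ‖f x‖ₑ := by
    have h : ‖fderiv ℝ (g n) x‖ ≤ ‖fderiv ℝ f x‖ + a n * K * ‖f x‖ := by
      rw [fderiv_fun_mul ((hχ n).differentiable one_ne_zero x) (hf.differentiable one_ne_zero x),
        fderiv_comp_smul]
      refine (norm_add_le _ _).trans ?_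
      simp only [norm_smul, Real.norm_eq_abs, abs_of_pos (ha_pos n), abs_of_nonneg φ.nonneg]
      have h1 := mul_le_mul_of_nonneg_right (φ.le_one (x := a n • x))
        (norm_nonneg (fderiv ℝ f x))
      have h2 := mul_le_mul_of_nonneg_left (hK (a n • x))
        (mul_nonneg (abs_nonneg (f x)) (ha_pos n).le)
      linarith
    have hK0 : 0 ≤ K := (norm_nonneg _).trans (hK 0)
    have hKa : 0 ≤ a n * K := mul_nonneg (ha_pos n).le hK0
    rw [← ofReal_norm, ← ofReal_norm, ← ofReal_norm, ← ENNReal.ofReal_mul hKa,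
      ← ENNReal.ofReal_add (norm_nonneg _) (by positivity)]
    exact ENNReal.ofReal_le_ofReal h
  have hbound (n : ℕ) : ∫⁻ x, ‖g n x‖ₑ ^ (2 : ℝ) ≤
      C * ((∫⁻ x, ‖fderiv ℝ f x‖ₑ) + ENNReal.ofReal (a n * K) * ∫⁻ x, ‖f x‖ₑ) ^ (2 : ℝ) := by
    refine (lintegral_pow_le_pow_lintegral_fderiv volume (hg n) (hg_supp n) (p := 2) ?_).trans ?_
    · rw [finrank_euclideanSpace_fin]
      exact_mod_cast Real.HolderConjugate.two_two
    · gcongr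
      refine (lintegral_mono (hg_fderiv n)).trans_eq ?_
      rw [lintegral_add_left (by have := hf.continuous_fderiv one_ne_zero; fun_prop),
        lintegral_const_mul _ (by have := hf.continuous; fun_prop)]
  have hlim : Tendsto
      (fun n => C * ((∫⁻ x, ‖fderiv ℝ f x‖ₑ) + ENNReal.ofReal (a n * K) * ∫⁻ x, ‖f x‖ₑ) ^ (2 : ℝ))
      atTop (𝓝 (C * (∫⁻ x, ‖fderiv ℝ f x‖ₑ) ^ (2 : ℝ))) := by
    refine ENNReal.Tendsto.const_mul ?_ (Or.inr ENNReal.coe_ne_top)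
    refine ((ENNReal.continuous_rpow_const (y := 2)).tendsto _).comp ?_
    have h0 : Tendsto (fun n => ENNReal.ofReal (a n * K)) atTop (𝓝 0) := by
      simpa using ENNReal.tendsto_ofReal (ha.mul_const K)
    have h1 := ENNReal.Tendsto.mul_const (b := ∫⁻ x, ‖f x‖ₑ) h0 (Or.inr hfi.2.ne)
    simpa using h1.const_add (∫⁻ x, ‖fderiv ℝ f x‖ₑ)
  calc ∫⁻ x, ‖f x‖ₑ ^ (2 : ℝ)
      = ∫⁻ x, liminf (fun n => ‖g n x‖ₑ ^ (2 : ℝ)) atTop := by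
        refine lintegral_congr fun x => (Tendsto.liminf_eq ?_).symm
        have h0 : Tendsto (fun n => ‖a n • x‖) atTop (𝓝 0) := by
          simpa using (ha.smul_const x).norm
        refine tendsto_const_nhds.congr' ?_
        filter_upwards [h0.eventually (gt_mem_nhds one_pos)] with n hn
        have : φ (a n • x) = 1 :=
          φ.one_of_mem_closedBall (by simpa [φ] using hn.le)
        simp [g, this]
    _ ≤ liminf (fun n => ∫⁻ x, ‖g n x‖ₑ ^ (2 : ℝ)) atTop :=
        lintegral_liminf_le fun n => by have := (hg n).continuous; fun_prop
    _ ≤ liminf (fun n => C * ((∫⁻ x, ‖fderiv ℝ f x‖ₑ) +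
          ENNReal.ofReal (a n * K) * ∫⁻ x, ‖f x‖ₑ) ^ (2 : ℝ)) atTop :=
        liminf_le_liminf (Eventually.of_forall hbound)
    _ = _ := hlim.liminf_eq

lemma exists_integral_sq_le_sq_integral_fderiv :
    ∃ C : ℝ, 0 < C ∧ ∀ f : Plane → ℝ, ContDiff ℝ 1 f → Integrable f →
      Integrable (fderiv ℝ f) → ∫ x, f x ^ 2 ≤ C * (∫ x, ‖fderiv ℝ f x‖) ^ 2 := by
  refine ⟨lintegralPowLePowLIntegralFDerivConst (volume : Measure Plane) 2 + 1, by positivity,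
    fun f hf hfi hdf => ?_⟩
  have h := lintegral_sq_le_sq_lintegral_fderiv hf hfi
  have htop : ∫⁻ x, ‖fderiv ℝ f x‖ₑ ≠ ⊤ := hdf.2.ne
  rw [integral_eq_lintegral_of_nonneg_ae (Filter.Eventually.of_forall fun x => sq_nonneg (f x))
    (hf.continuous.pow 2).aestronglyMeasurable, integral_norm_eq_lintegral_enorm hdf.1]
  have heq (x : Plane) : ENNReal.ofReal (f x ^ 2) = ‖f x‖ₑ ^ (2 : ℝ) := by
    rw [ENNReal.rpow_two, ← ofReal_norm, ← ENNReal.ofReal_pow (norm_nonneg _), Real.norm_eq_abs,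
      sq_abs]
  simp_rw [heq]
  refine (ENNReal.toReal_mono (by finiteness) h).trans ?_
  rw [ENNReal.toReal_mul, ENNReal.rpow_two, ENNReal.toReal_pow, ENNReal.coe_toReal]
  gcongr
  linarith

lemma sq_integral_mul_le {f g : Plane → ℝ} (hf : Continuous f) (hg : Continuous g)
    (hf0 : 0 ≤ f) (hg0 : 0 ≤ g) (hf2 : Integrable (fun x => f x ^ 2))
    (hg2 : Integrable (fun x => g x ^ 2)) :
    (∫ x, f x * g x) ^ 2 ≤ (∫ x, f x ^ 2) * ∫ x, g x ^ 2 := by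
  have hmf : MemLp f (ENNReal.ofReal 2) := by
    simpa using (memLp_two_iff_integrable_sq hf.aestronglyMeasurable).2 hf2
  have hmg : MemLp g (ENNReal.ofReal 2) := by
    simpa using (memLp_two_iff_integrable_sq hg.aestronglyMeasurable).2 hg2
  have h := integral_mul_le_Lp_mul_Lq_of_nonneg Real.HolderConjugate.two_two
    (Filter.Eventually.of_forall hf0) (Filter.Eventually.of_forall hg0) hmf hmg
  simp only [Real.rpow_two, ← Real.sqrt_eq_rpow] at h
  have h0 : 0 ≤ ∫ x, f x * g x := integral_nonneg fun x => mul_nonneg (hf0 x) (hg0 x)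
  refine (pow_le_pow_left₀ h0 h 2).trans_eq ?_
  rw [mul_pow, Real.sq_sqrt (integral_nonneg fun x => sq_nonneg (f x)),
    Real.sq_sqrt (integral_nonneg fun x => sq_nonneg (g x))]

lemma rpow_le_sq_add_rpow {q r t : ℝ} (hq : 2 ≤ q) (hqr : q ≤ r) (ht : 0 ≤ t) :
    t ^ q ≤ t ^ 2 + t ^ r := by
  rcases le_total t 1 with h | h
  · have h1 : t ^ q ≤ t ^ (2 : ℝ) := Real.rpow_le_rpow_of_exponent_ge' ht h zero_le_two hq
    rw [Real.rpow_two] at h1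
    linarith [Real.rpow_nonneg ht r]
  · linarith [Real.rpow_le_rpow_of_exponent_le h hqr, sq_nonneg t]

lemma sq_rpow_sub_one_le {p ε t : ℝ} (hp : 2 < p) (hε : 0 < ε) (ht : 0 ≤ t) :
    (t ^ (p - 1)) ^ 2 ≤ ε * t ^ (2 * p) + ε⁻¹ ^ (p - 2) * t ^ 2 := by
  rcases ht.eq_or_lt with rfl | ht
  · rw [Real.zero_rpow (by linarith), Real.zero_rpow (by linarith)]
    simp
  have e1 : (t ^ (p - 1)) ^ 2 = (t ^ 2) ^ (p - 2) * t ^ 2 := by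
    rw [← Real.rpow_natCast, ← Real.rpow_natCast, ← Real.rpow_mul ht.le, ← Real.rpow_mul ht.le,
      ← Real.rpow_add ht]
    congr 1; push_cast; ring
  have e2 : t ^ (2 * p) = (t ^ (p - 1)) ^ 2 * t ^ 2 := by
    rw [← Real.rpow_natCast, ← Real.rpow_natCast, ← Real.rpow_mul ht.le, ← Real.rpow_add ht]
    congr 1; push_cast; ring
  rcases le_total (t ^ 2) ε⁻¹ with h | h
  · have h1 := mul_le_mul_of_nonneg_right
      (Real.rpow_le_rpow (sq_nonneg t) h (by linarith : 0 ≤ p - 2)) (sq_nonneg t)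
    have h2 : 0 ≤ ε * t ^ (2 * p) := by positivity
    linarith
  · have h1 : 1 ≤ ε * t ^ 2 := by
      rwa [inv_le_iff_one_le_mul₀' hε] at h
    have h2 := le_mul_of_one_le_right (sq_nonneg (t ^ (p - 1))) h1
    have h3 : 0 ≤ ε⁻¹ ^ (p - 2) * t ^ 2 := by positivity
    rw [e2]
    linarith

/-- A Gagliardo–Nirenberg bound: on the plane, the `L²` norm of a function and of its derivative
control its `L^{2p}` norm. -/
lemma exists_integral_rpow_le {p : ℝ} (hp : 2 < p) (c D : ℝ) :
    ∃ A : ℝ, ∀ u : Plane → ℝ, ContDiff ℝ 1 u → Integrable (fun x => u x ^ 2) →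
      Integrable (fun x => |u x| ^ (2 * p)) → Integrable (fun x => ‖fderiv ℝ u x‖ ^ 2) →
      ∫ x, u x ^ 2 = c → ∫ x, ‖fderiv ℝ u x‖ ^ 2 ≤ D → ∫ x, |u x| ^ (2 * p) ≤ A := by
  obtain ⟨C, hC, hsob⟩ := exists_integral_sq_le_sq_integral_fderiv
  set E : ℝ := C * p ^ 2 * max D 1
  have hE : 0 < E := by positivity
  set ε : ℝ := (2 * E)⁻¹ with hε_def
  have hε : 0 < ε := by positivity
  refine ⟨2 * E * (ε⁻¹ ^ (p - 2) * c), fun u hu hu2 hup hdu huc huD => ?_⟩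
  have hcu := hu.continuous
  have hcd := hu.continuous_fderiv one_ne_zero
  have hpow : Continuous fun x => |u x| ^ (p - 1) :=
    hcu.abs.rpow_const fun x => Or.inr (by linarith)
  have hpow_le (x : Plane) := sq_rpow_sub_one_le hp hε (abs_nonneg (u x))
  simp only [sq_abs] at hpow_le
  have hint : Integrable fun x => ε * |u x| ^ (2 * p) + ε⁻¹ ^ (p - 2) * u x ^ 2 :=
    (hup.const_mul _).add (hu2.const_mul _)
  have hpow2 : Integrable fun x => (|u x| ^ (p - 1)) ^ 2 :=
    hint.mono' (hpow.pow 2).aestronglyMeasurable <| .of_forall fun x => by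
      rw [Real.norm_of_nonneg (sq_nonneg _)]
      exact hpow_le x
  have hmul : Integrable fun x => |u x| ^ (p - 1) * ‖fderiv ℝ u x‖ :=
    (hpow2.add hdu).mono' (hpow.mul hcd.norm).aestronglyMeasurable <| .of_forall fun x => by
      have h0 : 0 ≤ |u x| ^ (p - 1) := by positivity
      rw [Real.norm_of_nonneg (by positivity)]
      simp only [Pi.add_apply]
      nlinarith [sq_nonneg (|u x| ^ (p - 1) - ‖fderiv ℝ u x‖), norm_nonneg (fderiv ℝ u x)]
  have hf : ContDiff ℝ 1 fun x => |u x| ^ p := hu.norm_rpow (by linarith)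
  have hfi : Integrable fun x => |u x| ^ p :=
    (hu2.add hup).mono' hf.continuous.aestronglyMeasurable <| .of_forall fun x => by
      rw [Real.norm_of_nonneg (by positivity)]
      simpa using rpow_le_sq_add_rpow hp.le (by linarith : p ≤ 2 * p) (abs_nonneg (u x))
  have hdf_le (x : Plane) : ‖fderiv ℝ (fun x => |u x| ^ p) x‖ ≤
      p * (|u x| ^ (p - 1) * ‖fderiv ℝ u x‖) := by
    rw [← mul_assoc]
    exact norm_fderiv_norm_rpow_le (hu.differentiable one_ne_zero) (by linarith)
  have hdf : Integrable (fderiv ℝ fun x => |u x| ^ p) :=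
    (hmul.const_mul p).mono' (hf.continuous_fderiv one_ne_zero).aestronglyMeasurable
      (.of_forall hdf_le)
  have hsq (x : Plane) : (|u x| ^ p) ^ 2 = |u x| ^ (2 * p) := by
    rw [mul_comm, Real.rpow_mul (abs_nonneg _), Real.rpow_two]
  have key := hsob _ hf hfi hdf
  simp only [hsq] at key
  have h1 : ∫ x, ‖fderiv ℝ (fun x => |u x| ^ p) x‖ ≤
      p * ∫ x, |u x| ^ (p - 1) * ‖fderiv ℝ u x‖ := by
    rw [← integral_const_mul]
    exact integral_mono hdf.norm (hmul.const_mul p) hdf_le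
  have h2 := sq_integral_mul_le hpow hcd.norm (fun x => Real.rpow_nonneg (abs_nonneg _) _)
    (fun x => norm_nonneg _) hpow2 hdu
  have h3 : ∫ x, (|u x| ^ (p - 1)) ^ 2 ≤
      ε * (∫ x, |u x| ^ (2 * p)) + ε⁻¹ ^ (p - 2) * c := by
    refine (integral_mono hpow2 hint hpow_le).trans_eq ?_
    rw [integral_add (hup.const_mul _) (hu2.const_mul _), integral_const_mul, integral_const_mul,
      huc]
  have h4 : ∫ x, |u x| ^ (2 * p) ≤
      E * (ε * (∫ x, |u x| ^ (2 * p)) + ε⁻¹ ^ (p - 2) * c) := by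
    calc ∫ x, |u x| ^ (2 * p)
        ≤ C * (∫ x, ‖fderiv ℝ (fun x => |u x| ^ p) x‖) ^ 2 := key
      _ ≤ C * (p * ∫ x, |u x| ^ (p - 1) * ‖fderiv ℝ u x‖) ^ 2 := by gcongr
      _ = C * p ^ 2 * (∫ x, |u x| ^ (p - 1) * ‖fderiv ℝ u x‖) ^ 2 := by ring
      _ ≤ C * p ^ 2 * ((∫ x, (|u x| ^ (p - 1)) ^ 2) * max D 1) := by
          gcongr
          refine h2.trans ?_
          gcongr
          exact huD.trans (le_max_left _ _)
      _ = E * ∫ x, (|u x| ^ (p - 1)) ^ 2 := by ring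
      _ ≤ _ := by gcongr
  have h5 : E * ε = 1 / 2 := by rw [hε_def]; field_simp
  rw [mul_add, ← mul_assoc, h5] at h4
  linarith

/-- The negative part of the planar logarithmic kernel is integrable. -/
lemma integrable_max_neg_log_norm : Integrable fun x : Plane => max (-Real.log ‖x‖) 0 := by
  rw [integrable_fun_norm_addHaar volume (f := fun r => max (-Real.log r) 0),
    finrank_euclideanSpace_fin]
  have hI : IntegrableOn (fun _ : ℝ => (1 : ℝ)) (Set.Ioc 0 1) := by simp
  have h : IntegrableOn (fun r : ℝ => r ^ (2 - 1) • max (-Real.log r) 0) (Set.Ioc 0 1) := by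
    refine hI.mono' (by fun_prop) ?_
    refine (ae_restrict_iff' measurableSet_Ioc).2 (.of_forall fun r hr => ?_)
    have h1 := Real.log_le_sub_one_of_pos (inv_pos.2 hr.1)
    rw [Real.log_inv] at h1
    have h2 : r * r⁻¹ = 1 := mul_inv_cancel₀ hr.1.ne'
    have h3 : r * max (-Real.log r) 0 ≤ r * r⁻¹ := by
      have := hr.1
      gcongr
      exact max_le (by linarith) (by positivity)
    have h4 : 0 ≤ r * max (-Real.log r) 0 := mul_nonneg hr.1.le (le_max_right _ _)
    rw [smul_eq_mul, pow_one, Real.norm_of_nonneg h4]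
    linarith
  refine (h.of_forall_sdiff_eq_zero measurableSet_Ioi fun r hr => ?_)
  have hr1 : 1 < r := by
    by_contra! h1
    exact hr.2 ⟨hr.1, h1⟩
  simp [Real.log_nonneg hr1.le]

/-- The logarithmic interaction energy is bounded below by a multiple of `‖ρ‖₂²`. -/
lemma neg_mul_integral_sq_le_integral_log {ρ : Plane → ℝ} (hρ0 : 0 ≤ ρ)
    (hρ2 : Integrable fun x => ρ x ^ 2)
    (hint : Integrable fun z : Plane × Plane => Real.log ‖z.1 - z.2‖ * ρ z.1 * ρ z.2) :
    -((∫ x : Plane, max (-Real.log ‖x‖) 0) * ∫ x, ρ x ^ 2) ≤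
      ∫ z : Plane × Plane, Real.log ‖z.1 - z.2‖ * ρ z.1 * ρ z.2 := by
  set k : Plane → ℝ := fun x => max (-Real.log ‖x‖) 0
  have hk : Integrable k := integrable_max_neg_log_norm
  have hneg (x : Plane) : k (-x) = k x := by simp [k]
  have hF : Integrable fun z : Plane × Plane => k z.1 * ρ z.2 ^ 2 := hk.mul_prod hρ2
  have hmp : MeasurePreserving (fun z : Plane × Plane => (z.1 - z.2, z.2)) volume volume :=
    measurePreserving_sub_prod volume volume
  have hG : Integrable fun z : Plane × Plane => k (z.1 - z.2) * ρ z.2 ^ 2 :=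
    hmp.integrable_comp_of_integrable hF
  have hG_eq : ∫ z : Plane × Plane, k (z.1 - z.2) * ρ z.2 ^ 2 = (∫ x, k x) * ∫ x, ρ x ^ 2 := by
    rw [← integral_prod_mul, ← Measure.volume_eq_prod]
    have h := integral_map hmp.aemeasurable (by rw [hmp.map_eq]; exact hF.1)
    rw [hmp.map_eq] at h
    exact h.symm
  have hsymm (z : Plane × Plane) : k (z.1 - z.2) = k (z.2 - z.1) := by
    rw [← neg_sub, hneg]
  have hH : Integrable fun z : Plane × Plane => k (z.1 - z.2) * ρ z.1 ^ 2 := by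
    simp_rw [hsymm]
    exact hG.swap
  have hH_eq : ∫ z : Plane × Plane, k (z.1 - z.2) * ρ z.1 ^ 2 = (∫ x, k x) * ∫ x, ρ x ^ 2 := by
    simp_rw [hsymm]
    rw [← hG_eq]
    exact integral_prod_swap (μ := volume) (ν := volume)
      (fun z : Plane × Plane => k (z.1 - z.2) * ρ z.2 ^ 2)
  have hle (z : Plane × Plane) :
      -(1 / 2) * (k (z.1 - z.2) * ρ z.1 ^ 2 + k (z.1 - z.2) * ρ z.2 ^ 2) ≤
        Real.log ‖z.1 - z.2‖ * ρ z.1 * ρ z.2 := by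
    have h1 : -Real.log ‖z.1 - z.2‖ ≤ k (z.1 - z.2) := le_max_left _ _
    have h2 : 0 ≤ k (z.1 - z.2) := le_max_right _ _
    have h3 := mul_le_mul_of_nonneg_right h1 (mul_nonneg (hρ0 z.1) (hρ0 z.2))
    have h4 := mul_nonneg h2 (sq_nonneg (ρ z.1 - ρ z.2))
    linarith
  have h := integral_mono ((hH.add hG).const_mul _) hint hle
  rw [integral_const_mul] at h
  simp only [Pi.add_apply] at h
  rw [integral_add hH hG, hG_eq, hH_eq] at h
  linarith

lemma norm_gradient_eq_norm_fderiv (u : Plane → ℝ) (x : Plane) :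
    ‖gradient u x‖ = ‖fderiv ℝ u x‖ := by
  rw [← toDual_gradient, LinearIsometryEquiv.norm_map]

/-- For `p > 2` and positive parameters, the energy is bounded from below on the subset of
the constraint set where the Dirichlet energy is below `((p−1)/(p−2))·(c₁+c₂)²/4`. -/
theorem stmt13 (p β μ₁ μ₂ c₁ c₂ : ℝ) (hp : 2 < p) (hμ₁ : 0 < μ₁) (hμ₂ : 0 < μ₂)
    (hβ : 0 < β) (hc₁ : 0 < c₁) (hc₂ : 0 < c₂) :
    ∃ M : ℝ, 0 < M ∧ ∀ u v : Plane → ℝ, Admissible p c₁ c₂ u v →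
      (∫ x, ‖gradient u x‖ ^ 2 + ‖gradient v x‖ ^ 2) <
        (p - 1) / (p - 2) * (c₁ + c₂) ^ 2 / 4 →
      -M ≤ energy p μ₁ μ₂ β u v := by
  set D := (p - 1) / (p - 2) * (c₁ + c₂) ^ 2 / 4
  obtain ⟨A₁, hA₁⟩ := exists_integral_rpow_le hp c₁ D
  obtain ⟨A₂, hA₂⟩ := exists_integral_rpow_le hp c₂ D
  set L := ∫ x : Plane, max (-Real.log ‖x‖) 0
  have hL : 0 ≤ L := integral_nonneg fun x => le_max_right _ _
  set M := 1 / 4 * (L * (2 * (c₁ + A₁) + 2 * (c₂ + A₂))) +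
    1 / (2 * p) * (μ₁ * A₁ + μ₂ * A₂ + 2 * β * ((A₁ + A₂) / 2)) with hM_def
  refine ⟨max M 1, by positivity, fun u v huv hD => ?_⟩
  obtain ⟨hu, hv, hu2, hv2, hup, hvp, huc, hvc, hgrad, -, hlog⟩ := huv
  simp only [energy]
  simp only [norm_gradient_eq_norm_fderiv] at hgrad hD ⊢
  have hdu : Integrable fun x => ‖fderiv ℝ u x‖ ^ 2 :=
    hgrad.mono' ((hu.continuous_fderiv one_ne_zero).norm.pow 2).aestronglyMeasurable <|
      .of_forall fun x => by
        rw [Real.norm_of_nonneg (sq_nonneg _)]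
        linarith [sq_nonneg ‖fderiv ℝ v x‖]
  have hdv : Integrable fun x => ‖fderiv ℝ v x‖ ^ 2 :=
    hgrad.mono' ((hv.continuous_fderiv one_ne_zero).norm.pow 2).aestronglyMeasurable <|
      .of_forall fun x => by
        rw [Real.norm_of_nonneg (sq_nonneg _)]
        linarith [sq_nonneg ‖fderiv ℝ u x‖]
  rw [integral_add hdu hdv] at hD ⊢
  have hdu0 : 0 ≤ ∫ x, ‖fderiv ℝ u x‖ ^ 2 := integral_nonneg fun x => sq_nonneg _
  have hdv0 : 0 ≤ ∫ x, ‖fderiv ℝ v x‖ ^ 2 := integral_nonneg fun x => sq_nonneg _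
  have huA := hA₁ u hu hu2 hup hdu huc (by linarith)
  have hvA := hA₂ v hv hv2 hvp hdv hvc (by linarith)
  have h4 (t : ℝ) : t ^ 4 ≤ t ^ 2 + |t| ^ (2 * p) := by
    have h := rpow_le_sq_add_rpow (q := (4 : ℕ)) (r := 2 * p) (by norm_num)
      (by push_cast; linarith) (abs_nonneg t)
    rwa [Real.rpow_natCast, Even.pow_abs (by decide), sq_abs] at h
  have hρ_le (x : Plane) : (u x ^ 2 + v x ^ 2) ^ 2 ≤
      2 * (u x ^ 2 + |u x| ^ (2 * p)) + 2 * (v x ^ 2 + |v x| ^ (2 * p)) := by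
    linarith [h4 (u x), h4 (v x), sq_nonneg (u x ^ 2 - v x ^ 2)]
  have hρ_bound : Integrable fun x =>
      2 * (u x ^ 2 + |u x| ^ (2 * p)) + 2 * (v x ^ 2 + |v x| ^ (2 * p)) :=
    ((hu2.add hup).const_mul 2).add ((hv2.add hvp).const_mul 2)
  have hρ2 : Integrable fun x => (u x ^ 2 + v x ^ 2) ^ 2 :=
    hρ_bound.mono' (((hu.continuous.pow 2).add (hv.continuous.pow 2)).pow 2).aestronglyMeasurable
      (.of_forall fun x => by rw [Real.norm_of_nonneg (sq_nonneg _)]; exact hρ_le x)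
  have hρ_int : ∫ x, (u x ^ 2 + v x ^ 2) ^ 2 ≤ 2 * (c₁ + A₁) + 2 * (c₂ + A₂) := by
    have h := integral_mono hρ2 hρ_bound hρ_le
    have hU : Integrable fun x => 2 * (u x ^ 2 + |u x| ^ (2 * p)) := (hu2.add hup).const_mul 2
    have hV : Integrable fun x => 2 * (v x ^ 2 + |v x| ^ (2 * p)) := (hv2.add hvp).const_mul 2
    rw [integral_add hU hV, integral_const_mul, integral_const_mul, integral_add hu2 hup, integral_add hv2 hvp,
      huc, hvc] at h
    linarith
  have hlog_ge : -(L * _) ≤ _ := neg_mul_integral_sq_le_integral_log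
    (ρ := fun x => u x ^ 2 + v x ^ 2) (fun x => by positivity) hρ2 hlog
  have hL_le := mul_le_mul_of_nonneg_left hρ_int hL
  have hcross : ∫ x, |u x * v x| ^ p ≤ (A₁ + A₂) / 2 := by
    have hle (x : Plane) : |u x * v x| ^ p ≤ (|u x| ^ (2 * p) + |v x| ^ (2 * p)) / 2 := by
      rw [abs_mul, Real.mul_rpow (abs_nonneg _) (abs_nonneg _), mul_comm 2 p,
        Real.rpow_mul (abs_nonneg _), Real.rpow_mul (abs_nonneg _), Real.rpow_two, Real.rpow_two]
      linarith [sq_nonneg (|u x| ^ p - |v x| ^ p)]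
    have h := integral_mono_of_nonneg (.of_forall fun x => Real.rpow_nonneg (abs_nonneg _) p)
      ((hup.add hvp).div_const 2) (.of_forall hle)
    refine h.trans ?_
    simp only [Pi.add_apply]
    rw [integral_div, integral_add hup hvp]
    linarith
  have hnonlin : 1 / (2 * p) * (μ₁ * (∫ x, |u x| ^ (2 * p)) + μ₂ * (∫ x, |v x| ^ (2 * p)) +
      2 * β * (∫ x, |u x * v x| ^ p)) ≤
      1 / (2 * p) * (μ₁ * A₁ + μ₂ * A₂ + 2 * β * ((A₁ + A₂) / 2)) := by
    gcongr
  have hM : M ≤ max M 1 := le_max_left _ _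
  rw [hM_def] at hM
  linarith
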